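/- arXiv:2106.00287 — 2 statements merged into one kernel-verified Lean document; each statement's English description precedes it below -/
import Mathlib

section
/- Let k ≥ 1 be an integer, τ > 0, let f : {−1,1}^n → {−1,1}, and let g : {−1,1}^n → {−1,1} be a junta on a set U ⊆ [n] with |U| ≤ k. Let S = {i ∈ U : Inf_i^{≤k}[f] ≥ τ²/k}. Then there exists h : {−1,1}^n → {−1,1} that is a junta on S with E_{x uniform}[f(x)·h(x)] ≥ E_{x uniform}[f(x)·g(x)] − τ. -/
open Finset

noncomputable section

/-- The real sign of a Boolean bit: `true ↦ 1`, `false ↦ -1`. -/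
def sgnB (b : Bool) : ℝ := if b then 1 else -1

/-- The character `χ_S(x) = ∏_{i ∈ S} x_i` on the cube `{±1}^n`. -/
def chi {n : ℕ} (S : Finset (Fin n)) (x : Fin n → Bool) : ℝ := ∏ i ∈ S, sgnB (x i)

/-- The Fourier coefficient `f̂(S) = 2^{-n} ∑_x f(x) χ_S(x)`. -/
def fhat {n : ℕ} (f : (Fin n → Bool) → ℝ) (S : Finset (Fin n)) : ℝ :=
  (∑ x : Fin n → Bool, f x * chi S x) / 2 ^ n

/-- Expectation over a uniformly random point of the cube. -/
def expect {n : ℕ} (f : (Fin n → Bool) → ℝ) : ℝ := (∑ x : Fin n → Bool, f x) / 2 ^ n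

/-- `f_{avg,T}(x) = ∑_{S ⊆ T} f̂(S) χ_S(x)`, the conditional expectation of `f` given `x_T`. -/
def favg {n : ℕ} (f : (Fin n → Bool) → ℝ) (T : Finset (Fin n)) (x : Fin n → Bool) : ℝ :=
  ∑ S ∈ T.powerset, fhat f S * chi S x

/-- `g` is a junta on `T` if it depends only on the coordinates in `T`. -/
def IsJuntaOn {n : ℕ} (g : (Fin n → Bool) → ℝ) (T : Finset (Fin n)) : Prop :=
  ∀ x y : Fin n → Bool, (∀ i ∈ T, x i = y i) → g x = g y

/-- The restriction `f_{B→z}`, viewed as a function on the whole cube that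
ignores the coordinates in `B` (they are fixed to `z`). -/
def restrictF {n : ℕ} (f : (Fin n → Bool) → ℝ) (B : Finset (Fin n)) (z : Fin n → Bool) :
    (Fin n → Bool) → ℝ :=
  fun x => f (fun i => if i ∈ B then z i else x i)

/-- Expectation over a `δ`-random restriction `(J, z) ∼ R_δ`: `J` contains each
coordinate independently with probability `δ`, and `z` is uniform (only its values
outside `J` matter for the functionals we apply this to). -/
def Erestrict {n : ℕ} (δ : ℝ) (F : Finset (Fin n) → (Fin n → Bool) → ℝ) : ℝ :=
  ∑ J : Finset (Fin n), δ ^ J.card * (1 - δ) ^ (n - J.card) *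
    ((∑ z : Fin n → Bool, F J z) / 2 ^ n)

/-- `dist(f,g) = Pr_x[f(x) ≠ g(x)]`. -/
def distF {n : ℕ} (f g : (Fin n → Bool) → ℝ) : ℝ :=
  expect (fun x => if f x = g x then 0 else 1)
theorem sgnB_mul_self (b : Bool) : sgnB b * sgnB b = 1 := by cases b <;> simp [sgnB]

theorem sum_chi_mul_chi {n : ℕ} (x y : Fin n → Bool) :
    ∑ S : Finset (Fin n), chi S x * chi S y = if x = y then 2 ^ n else 0 := by
  have h : ∑ S : Finset (Fin n), chi S x * chi S y = ∏ i, (1 + sgnB (x i) * sgnB (y i)) := by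
    rw [Finset.prod_one_add, Finset.powerset_univ]
    exact Finset.sum_congr rfl fun S _ => Finset.prod_mul_distrib.symm
  rw [h]
  split_ifs with hxy
  · subst hxy
    simp [sgnB_mul_self, one_add_one_eq_two]
  · obtain ⟨i, hi⟩ := Function.ne_iff.mp hxy
    refine Finset.prod_eq_zero (Finset.mem_univ i) ?_
    cases hx : x i <;> cases hy : y i <;> simp_all [sgnB]

/-- Fourier inversion on the cube. -/
theorem sum_fhat_mul_chi {n : ℕ} (f : (Fin n → Bool) → ℝ) (x : Fin n → Bool) :
    ∑ S, fhat f S * chi S x = f x := by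
  have h : ∀ S, fhat f S * chi S x = ∑ y, f y * (chi S y * chi S x) / 2 ^ n := fun S => by
    rw [fhat, div_mul_eq_mul_div, Finset.sum_mul, Finset.sum_div]
    simp only [mul_assoc]
  simp_rw [h]
  rw [Finset.sum_comm]
  simp_rw [← Finset.sum_div, ← Finset.mul_sum, sum_chi_mul_chi]
  simp

theorem expect_sum_mul_chi {n : ℕ} (c : Finset (Fin n) → ℝ) (A : Finset (Finset (Fin n)))
    (g : (Fin n → Bool) → ℝ) :
    expect (fun x => (∑ S ∈ A, c S * chi S x) * g x) = ∑ S ∈ A, c S * fhat g S := by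
  simp only [_root_.expect, fhat, Finset.sum_mul, mul_div_assoc']
  rw [Finset.sum_comm, ← Finset.sum_div]
  simp only [Finset.mul_sum]
  congr! 3
  ring

/-- Plancherel's identity. -/
theorem expect_mul_eq_sum_fhat {n : ℕ} (f g : (Fin n → Bool) → ℝ) :
    expect (fun x => f x * g x) = ∑ S, fhat f S * fhat g S := by
  rw [← expect_sum_mul_chi]
  simp only [sum_fhat_mul_chi]

theorem IsJuntaOn.fhat_eq_zero {n : ℕ} {g : (Fin n → Bool) → ℝ} {U S : Finset (Fin n)}
    (hg : IsJuntaOn g U) (hS : ¬ S ⊆ U) : fhat g S = 0 := by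
  obtain ⟨i, hiS, hiU⟩ := Finset.not_subset.mp hS
  have hflip : Function.Involutive fun x : Fin n → Bool => Function.update x i (!x i) := by
    intro x
    simp
  have hterm : ∀ x : Fin n → Bool, g (Function.update x i (!x i)) *
      chi S (Function.update x i (!x i)) = -(g x * chi S x) := by
    intro x
    have h1 : g (Function.update x i (!x i)) = g x := hg _ _ fun j hj =>
      Function.update_of_ne (ne_of_mem_of_not_mem hj hiU) _ _
    have h2 : ∏ j ∈ S.erase i, sgnB (Function.update x i (!x i) j) =
        ∏ j ∈ S.erase i, sgnB (x j) := Finset.prod_congr rfl fun j hj => by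
      rw [Function.update_of_ne (Finset.ne_of_mem_erase hj)]
    have h3 : sgnB (!x i) = -sgnB (x i) := by cases x i <;> simp [sgnB]
    rw [h1, chi, chi, ← Finset.mul_prod_erase S _ hiS, ← Finset.mul_prod_erase S _ hiS, h2,
      Function.update_self, h3]
    ring
  have hsum := Equiv.sum_comp hflip.toPerm fun x => g x * chi S x
  simp only [Function.Involutive.coe_toPerm, hterm, Finset.sum_neg_distrib] at hsum
  rw [fhat, show ∑ x, g x * chi S x = 0 by linarith, zero_div]

theorem IsJuntaOn.expect_mul_eq {n : ℕ} {g : (Fin n → Bool) → ℝ} {U : Finset (Fin n)}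
    (hg : IsJuntaOn g U) (f : (Fin n → Bool) → ℝ) :
    expect (fun x => f x * g x) = ∑ S ∈ U.powerset, fhat f S * fhat g S := by
  rw [expect_mul_eq_sum_fhat]
  refine (Finset.sum_subset (Finset.subset_univ _) fun S _ hS => ?_).symm
  rw [hg.fhat_eq_zero (by simpa using hS), mul_zero]

theorem expect_favg_mul {n : ℕ} (f g : (Fin n → Bool) → ℝ) (T : Finset (Fin n)) :
    expect (fun x => favg f T x * g x) = ∑ S ∈ T.powerset, fhat f S * fhat g S :=
  expect_sum_mul_chi _ _ _

theorem isJuntaOn_favg {n : ℕ} (f : (Fin n → Bool) → ℝ) (T : Finset (Fin n)) :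
    IsJuntaOn (favg f T) T := by
  intro x y hxy
  refine Finset.sum_congr rfl fun S hS => ?_
  rw [chi, chi, Finset.prod_congr rfl fun i hi => by rw [hxy i (Finset.mem_powerset.mp hS hi)]]

/-- The sum of the squared Fourier coefficients of a sign-valued function is `1`. -/
theorem sum_fhat_sq_eq_one {n : ℕ} {g : (Fin n → Bool) → ℝ} (hg : ∀ x, g x = 1 ∨ g x = -1) :
    ∑ S, fhat g S ^ 2 = 1 := by
  have hsq : ∀ x, g x * g x = 1 := fun x => by rcases hg x with h | h <;> simp [h]
  simp_rw [sq, ← expect_mul_eq_sum_fhat, hsq]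
  simp [_root_.expect]

/-- The best sign-valued junta on `T` correlates with `f` at least as well as the part of `g`
supported on `T`. -/
theorem exists_junta_expect_ge {n : ℕ} (f g : (Fin n → Bool) → ℝ)
    (hg : ∀ x, g x = 1 ∨ g x = -1) (T : Finset (Fin n)) :
    ∃ h : (Fin n → Bool) → ℝ, (∀ x, h x = 1 ∨ h x = -1) ∧ IsJuntaOn h T ∧
      ∑ S ∈ T.powerset, fhat f S * fhat g S ≤ expect (fun x => f x * h x) := by
  have hh : IsJuntaOn (fun x => if 0 ≤ favg f T x then (1 : ℝ) else -1) T := fun x y hxy => by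
    simp only [isJuntaOn_favg f T x y hxy]
  refine ⟨_, fun x => ?_, hh, ?_⟩
  · split_ifs <;> simp
  · rw [hh.expect_mul_eq, ← expect_favg_mul, ← expect_favg_mul, _root_.expect, _root_.expect]
    refine div_le_div_of_nonneg_right (Finset.sum_le_sum fun x _ => ?_) (by positivity)
    split_ifs with h <;> rcases hg x with h' | h' <;> rw [h'] <;> linarith

/-- The Fourier weight on the subsets of `U` that meet `U \ T` is at most the total low-degree
influence of `U \ T`. -/
theorem sum_fhat_sq_le_sum_influence {n k : ℕ} (f : (Fin n → Bool) → ℝ)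
    {U : Finset (Fin n)} (hU : U.card ≤ k) (T : Finset (Fin n)) :
    ∑ S ∈ U.powerset \ T.powerset, fhat f S ^ 2 ≤
      ∑ i ∈ U \ T, ∑ S ∈ Finset.univ.filter
        (fun S : Finset (Fin n) => i ∈ S ∧ S.card ≤ k), fhat f S ^ 2 := by
  simp_rw [Finset.sum_filter]
  rw [Finset.sum_comm]
  have hnonneg : ∀ (S : Finset (Fin n)) (i : Fin n),
      0 ≤ if i ∈ S ∧ S.card ≤ k then fhat f S ^ 2 else 0 := fun S i => by positivity
  refine (Finset.sum_le_sum fun S hS => ?_).trans (Finset.sum_le_sum_of_subset_of_nonneg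
    (Finset.subset_univ _) fun S _ _ => Finset.sum_nonneg fun i _ => hnonneg S i)
  rw [Finset.mem_sdiff, Finset.mem_powerset, Finset.mem_powerset] at hS
  obtain ⟨i, hiS, hiT⟩ := Finset.not_subset.mp hS.2
  refine le_trans ?_ (Finset.single_le_sum (fun i _ => hnonneg S i)
    (Finset.mem_sdiff.mpr ⟨hS.1 hiS, hiT⟩))
  rw [if_pos ⟨hiS, (Finset.card_le_card hS.1).trans hU⟩]

/-- restricting to the coordinates of `U` with large low-degree
influence loses at most `τ` of correlation. -/
theorem junta_on_influential_coords (n k : ℕ) (hk : 1 ≤ k) (τ : ℝ) (hτ : 0 < τ)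
    (f g : (Fin n → Bool) → ℝ)
    (hf : ∀ x, f x = 1 ∨ f x = -1) (hg : ∀ x, g x = 1 ∨ g x = -1)
    (U : Finset (Fin n)) (hU : U.card ≤ k) (hjunta : IsJuntaOn g U) :
    ∃ h : (Fin n → Bool) → ℝ, (∀ x, h x = 1 ∨ h x = -1) ∧
      IsJuntaOn h (U.filter (fun i =>
        τ ^ 2 / k ≤ ∑ S ∈ Finset.univ.filter
            (fun S : Finset (Fin n) => i ∈ S ∧ S.card ≤ k), fhat f S ^ 2)) ∧
      expect (fun x => f x * g x) - τ ≤ expect (fun x => f x * h x) := by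
  set T := U.filter (fun i => τ ^ 2 / k ≤ ∑ S ∈ Finset.univ.filter
    (fun S : Finset (Fin n) => i ∈ S ∧ S.card ≤ k), fhat f S ^ 2) with hT
  obtain ⟨h, hh, hhT, hle⟩ := exists_junta_expect_ge f g hg T
  refine ⟨h, hh, hhT, ?_⟩
  have hk0 : (0 : ℝ) < k := by exact_mod_cast hk
  have hweight : ∑ S ∈ U.powerset \ T.powerset, fhat f S ^ 2 ≤ τ ^ 2 := calc
    _ ≤ _ := sum_fhat_sq_le_sum_influence f hU T
    _ ≤ ∑ _i ∈ U \ T, τ ^ 2 / k := Finset.sum_le_sum fun i hi => by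
      rw [Finset.mem_sdiff, hT, Finset.mem_filter, not_and] at hi
      exact (not_le.mp (hi.2 hi.1)).le
    _ ≤ k * (τ ^ 2 / k) := by
      rw [Finset.sum_const, nsmul_eq_mul]
      gcongr
      exact (Finset.card_le_card Finset.sdiff_subset).trans hU
    _ = τ ^ 2 := by field_simp
  have hweight' : ∑ S ∈ U.powerset \ T.powerset, fhat g S ^ 2 ≤ 1 :=
    (Finset.sum_le_sum_of_subset_of_nonneg (Finset.subset_univ _)
      fun S _ _ => sq_nonneg _).trans_eq (sum_fhat_sq_eq_one hg)
  have hcs : ∑ S ∈ U.powerset \ T.powerset, fhat f S * fhat g S ≤ τ := by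
    refine (abs_le.mp (abs_le_of_sq_le_sq ?_ hτ.le)).2
    calc _ ≤ _ := Finset.sum_mul_sq_le_sq_mul_sq _ _ _
      _ ≤ τ ^ 2 * 1 := by gcongr
      _ = τ ^ 2 := mul_one _
  have hsplit := Finset.sum_sdiff (f := fun S => fhat f S * fhat g S)
    (Finset.powerset_mono.mpr (Finset.filter_subset _ U : T ⊆ U))
  rw [hjunta.expect_mul_eq]
  linarith
end
end

section
/- Let k ≥ 1 be an integer and 0 < ε < 1; set ρ = 1 − √(ε/k) and κ = √(εk). Let f : {−1,1}^n → {−1,1} and B ⊆ U ⊆ [n], and suppose E_{z uniform in {−1,1}^B}[ Σ_{S⊆U∖B, |S|≥κ} f̂_{B→z}(S)² ] ≤ ε²/4. Then | E_{z,x}| Σ_{S⊆U∖B} f̂_{B→z}(S)·χ_S(x) | − E_{z,x}| Σ_{S⊆U∖B} f̂_{B→z}(S)·ρ^{|S|}·χ_S(x) | | ≤ 1.2·ε, where z is uniform in {−1,1}^B and x is uniform in {−1,1}^{[n]∖B}. -/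
open Finset

noncomputable section

theorem expect_mono {n : ℕ} {f g : (Fin n → Bool) → ℝ} (h : ∀ x, f x ≤ g x) :
    expect f ≤ expect g := by
  unfold _root_.expect
  gcongr with x
  exact h x

theorem expect_add {n : ℕ} (f g : (Fin n → Bool) → ℝ) :
    expect (fun x => f x + g x) = expect f + expect g := by
  simp only [_root_.expect, Finset.sum_add_distrib, add_div]

theorem expect_sub {n : ℕ} (f g : (Fin n → Bool) → ℝ) :
    expect (fun x => f x - g x) = expect f - expect g := by
  simp only [_root_.expect, Finset.sum_sub_distrib, sub_div]

theorem expect_const_mul {n : ℕ} (c : ℝ) (f : (Fin n → Bool) → ℝ) :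
    expect (fun x => c * f x) = c * expect f := by
  simp only [_root_.expect, ← Finset.mul_sum, mul_div_assoc]

theorem expect_const {n : ℕ} (c : ℝ) : expect (fun _ : Fin n → Bool => c) = c := by
  simp [_root_.expect]

theorem expect_sum {n : ℕ} {ι : Type*} (s : Finset ι) (F : ι → (Fin n → Bool) → ℝ) :
    expect (fun x => ∑ i ∈ s, F i x) = ∑ i ∈ s, expect (F i) := by
  simp only [_root_.expect]
  rw [Finset.sum_comm, Finset.sum_div]

theorem abs_expect_le {n : ℕ} (f : (Fin n → Bool) → ℝ) :
    |expect f| ≤ expect (fun x => |f x|) := by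
  unfold _root_.expect
  rw [abs_div, abs_of_pos (by positivity : (0 : ℝ) < 2 ^ n)]
  gcongr
  exact Finset.abs_sum_le_sum_abs _ _

theorem abs_expect_abs_sub_le {n : ℕ} (f g : (Fin n → Bool) → ℝ) :
    |expect (fun x => |f x|) - expect (fun x => |g x|)| ≤ expect (fun x => |f x - g x|) := by
  rw [← expect_sub]
  exact (abs_expect_le _).trans (expect_mono fun x => abs_abs_sub_abs_le (f x) (g x))

/-- The characters are orthonormal for the uniform measure on the cube. -/
theorem expect_chi_mul_chi {n : ℕ} (S T : Finset (Fin n)) :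
    expect (fun x => chi S x * chi T x) = if S = T then 1 else 0 := by
  have key : ∑ x : Fin n → Bool, chi S x * chi T x =
      ∏ i : Fin n, ∑ b : Bool, (if i ∈ S then sgnB b else 1) * (if i ∈ T then sgnB b else 1) := by
    rw [Fintype.prod_sum]
    refine Finset.sum_congr rfl fun x _ => ?_
    rw [Finset.prod_mul_distrib]
    simp [chi, Finset.prod_ite_mem]
  unfold _root_.expect
  rw [key]
  split_ifs with h
  · subst h
    have hfactor : ∀ i : Fin n, ∑ b : Bool,
        (if i ∈ S then sgnB b else 1) * (if i ∈ S then sgnB b else 1) = 2 := by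
      intro i
      by_cases hi : i ∈ S <;> simp [hi, sgnB]; norm_num
    rw [Finset.prod_congr rfl fun i _ => hfactor i]
    simp
  · obtain ⟨i, hi⟩ : ∃ i, ¬(i ∈ S ↔ i ∈ T) := by
      by_contra! hc
      exact h (Finset.ext hc)
    rw [Finset.prod_eq_zero (Finset.mem_univ i), zero_div]
    by_cases hS : i ∈ S <;> by_cases hT : i ∈ T <;> simp_all [sgnB]

/-- Parseval's identity for a Fourier expansion supported on `A`. -/
theorem expect_sq_sum_mul_chi {n : ℕ} (A : Finset (Finset (Fin n))) (c : Finset (Fin n) → ℝ) :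
    expect (fun x => (∑ S ∈ A, c S * chi S x) ^ 2) = ∑ S ∈ A, c S ^ 2 := by
  have hexpand : ∀ x : Fin n → Bool, (∑ S ∈ A, c S * chi S x) ^ 2 =
      ∑ S ∈ A, ∑ T ∈ A, c S * c T * (chi S x * chi T x) := by
    intro x
    rw [sq, Finset.sum_mul_sum]
    refine Finset.sum_congr rfl fun S _ => Finset.sum_congr rfl fun T _ => by ring
  simp only [hexpand, expect_sum, expect_const_mul, expect_chi_mul_chi]
  refine Finset.sum_congr rfl fun S hS => ?_
  simp [hS, sq]

theorem expect_mul_chi {n : ℕ} (g : (Fin n → Bool) → ℝ) (S : Finset (Fin n)) :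
    expect (fun x => g x * chi S x) = fhat g S := rfl

/-- Bessel's inequality for Fourier coefficients on the cube. -/
theorem sum_fhat_sq_le {n : ℕ} (g : (Fin n → Bool) → ℝ) (A : Finset (Finset (Fin n))) :
    ∑ S ∈ A, fhat g S ^ 2 ≤ expect (fun x => g x ^ 2) := by
  have hnonneg : 0 ≤ expect (fun x => (g x - ∑ S ∈ A, fhat g S * chi S x) ^ 2) := by
    unfold _root_.expect
    positivity
  have hexpand : ∀ x, (g x - ∑ S ∈ A, fhat g S * chi S x) ^ 2 =
      g x ^ 2 - 2 * ∑ S ∈ A, fhat g S * (g x * chi S x) +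
        (∑ S ∈ A, fhat g S * chi S x) ^ 2 := by
    intro x
    have : ∑ S ∈ A, fhat g S * (g x * chi S x) = g x * ∑ S ∈ A, fhat g S * chi S x := by
      rw [Finset.mul_sum]
      exact Finset.sum_congr rfl fun S _ => by ring
    rw [this]
    ring
  simp only [hexpand] at hnonneg
  rw [expect_add, expect_sub, expect_const_mul, expect_sum, expect_sq_sum_mul_chi] at hnonneg
  simp only [expect_const_mul, expect_mul_chi, ← sq] at hnonneg
  linarith

theorem expect_abs_le {n : ℕ} {ε : ℝ} (hε : 0 < ε) (f : (Fin n → Bool) → ℝ) :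
    expect (fun x => |f x|) ≤ (2 * ε)⁻¹ * expect (fun x => f x ^ 2) + ε / 2 := by
  rw [← expect_const_mul, ← expect_const (n := n) (ε / 2), ← expect_add]
  refine expect_mono fun x => ?_
  rw [← sq_abs (f x), ← sub_nonneg]
  have : (2 * ε)⁻¹ * |f x| ^ 2 + ε / 2 - |f x| = (2 * ε)⁻¹ * (|f x| - ε) ^ 2 := by
    field_simp
    ring
  rw [this]
  positivity

theorem one_sub_pow_sq_le_one {ρ : ℝ} (h0 : 0 ≤ ρ) (h1 : ρ ≤ 1) (s : ℕ) :
    (1 - ρ ^ s) ^ 2 ≤ 1 := by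
  have := pow_nonneg h0 s
  have := pow_le_one₀ (n := s) h0 h1
  nlinarith

/-- The noise operator with parameter `1 - δ` changes a function of Fourier degree below `κ`
by at most `δ κ` in relative `L²` norm; the remaining Fourier mass changes by at most itself. -/
theorem sum_sq_mul_one_sub_pow_sq_le {n : ℕ} {δ κ : ℝ} (hδ0 : 0 ≤ δ) (hδ1 : δ ≤ 1)
    (A : Finset (Finset (Fin n))) (c : Finset (Fin n) → ℝ) :
    ∑ S ∈ A, (c S * (1 - (1 - δ) ^ S.card)) ^ 2 ≤
      (δ * κ) ^ 2 * ∑ S ∈ A, c S ^ 2 +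
        ∑ S ∈ A.filter (fun S => κ ≤ (S.card : ℝ)), c S ^ 2 := by
  rw [Finset.sum_filter, Finset.mul_sum, ← Finset.sum_add_distrib]
  refine Finset.sum_le_sum fun S _ => ?_
  rw [mul_pow]
  split_ifs with h
  · have := one_sub_pow_sq_le_one (sub_nonneg.2 hδ1) (sub_le_self 1 hδ0) S.card
    nlinarith [sq_nonneg (c S), mul_nonneg (sq_nonneg (δ * κ)) (sq_nonneg (c S))]
  · have hbern : 1 + (S.card : ℝ) * (-δ) ≤ (1 + -δ) ^ S.card :=
      one_add_mul_le_pow (by linarith) _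
    have hle : 1 - (1 - δ) ^ S.card ≤ δ * κ := by
      rw [← sub_eq_add_neg] at hbern
      have := mul_le_mul_of_nonneg_left (not_le.1 h).le hδ0
      linarith
    have hge : 0 ≤ 1 - (1 - δ) ^ S.card :=
      sub_nonneg.2 (pow_le_one₀ (sub_nonneg.2 hδ1) (sub_le_self 1 hδ0))
    have := mul_le_mul_of_nonneg_left (pow_le_pow_left₀ hge hle 2) (sq_nonneg (c S))
    linarith

/-- if little Fourier mass of the restrictions lies above level
`κ = √(εk)`, then applying the noise operator `T_ρ` with `ρ = 1 - √(ε/k)` changes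
the expected absolute value by at most `1.2·ε`. -/
theorem noise_preserves_correlation (n k : ℕ) (hk : 1 ≤ k) (ε : ℝ)
    (hε0 : 0 < ε) (hε1 : ε < 1)
    (f : (Fin n → Bool) → ℝ) (hf : ∀ x, f x = 1 ∨ f x = -1)
    (B U : Finset (Fin n)) (hBU : B ⊆ U)
    (hmass : expect (fun z => ∑ S ∈ (U \ B).powerset.filter
          (fun S => Real.sqrt (ε * k) ≤ (S.card : ℝ)),
        fhat (restrictF f B z) S ^ 2) ≤ ε ^ 2 / 4) :
    |expect (fun z => expect (fun x =>
        |∑ S ∈ (U \ B).powerset, fhat (restrictF f B z) S * chi S x|))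
      - expect (fun z => expect (fun x =>
        |∑ S ∈ (U \ B).powerset, fhat (restrictF f B z) S *
            (1 - Real.sqrt (ε / k)) ^ S.card * chi S x|))| ≤ 1.2 * ε := by
  have hk0 : (0 : ℝ) < k := by exact_mod_cast hk
  have hk1 : (1 : ℝ) ≤ k := by exact_mod_cast hk
  have hδ1 : Real.sqrt (ε / k) ≤ 1 :=
    Real.sqrt_le_one.2 ((div_le_one hk0).2 (hε1.le.trans hk1))
  have hδκ : Real.sqrt (ε / k) * Real.sqrt (ε * k) = ε := by
    rw [← Real.sqrt_mul (by positivity), show ε / k * (ε * k) = ε ^ 2 by field_simp,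
      Real.sqrt_sq hε0.le]
  have hBessel : ∀ z, ∑ S ∈ (U \ B).powerset, fhat (restrictF f B z) S ^ 2 ≤ 1 := by
    intro z
    refine (sum_fhat_sq_le _ _).trans_eq ?_
    have hsq : ∀ x, restrictF f B z x ^ 2 = 1 := fun x => by
      rcases hf (fun i => if i ∈ B then z i else x i) with h | h <;> simp [restrictF, h]
    simp only [hsq, expect_const]
  have hrestrict : ∀ z,
      |expect (fun x => |∑ S ∈ (U \ B).powerset, fhat (restrictF f B z) S * chi S x|)
        - expect (fun x => |∑ S ∈ (U \ B).powerset, fhat (restrictF f B z) S *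
            (1 - Real.sqrt (ε / k)) ^ S.card * chi S x|)| ≤
      (2 * ε)⁻¹ * ∑ S ∈ (U \ B).powerset.filter (fun S => Real.sqrt (ε * k) ≤ (S.card : ℝ)),
        fhat (restrictF f B z) S ^ 2 + ε := by
    intro z
    refine (abs_expect_abs_sub_le _ _).trans ((expect_abs_le hε0 _).trans ?_)
    have hdiff : ∀ x, (∑ S ∈ (U \ B).powerset, fhat (restrictF f B z) S * chi S x)
        - ∑ S ∈ (U \ B).powerset, fhat (restrictF f B z) S *
            (1 - Real.sqrt (ε / k)) ^ S.card * chi S x =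
        ∑ S ∈ (U \ B).powerset, fhat (restrictF f B z) S *
            (1 - (1 - Real.sqrt (ε / k)) ^ S.card) * chi S x := by
      intro x
      rw [← Finset.sum_sub_distrib]
      exact Finset.sum_congr rfl fun S _ => by ring
    simp only [hdiff, expect_sq_sum_mul_chi]
    have hsum := sum_sq_mul_one_sub_pow_sq_le (κ := Real.sqrt (ε * k)) (Real.sqrt_nonneg _) hδ1
      (U \ B).powerset (fhat (restrictF f B z))
    rw [hδκ] at hsum
    have hlow := mul_le_mul_of_nonneg_left (hBessel z) (sq_nonneg ε)
    have hscaled := mul_le_mul_of_nonneg_left (hsum.trans (add_le_add_left hlow _))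
      (by positivity : 0 ≤ (2 * ε)⁻¹)
    have hcancel : (2 * ε)⁻¹ * (ε ^ 2 * 1) = ε / 2 := by field_simp
    rw [mul_add, hcancel] at hscaled
    linarith
  rw [← expect_sub]
  refine (abs_expect_le _).trans ((expect_mono hrestrict).trans ?_)
  rw [expect_add, expect_const_mul, expect_const]
  have hscaled := mul_le_mul_of_nonneg_left hmass (by positivity : 0 ≤ (2 * ε)⁻¹)
  have hcancel : (2 * ε)⁻¹ * (ε ^ 2 / 4) = ε / 8 := by
    field_simp
    norm_num
  rw [hcancel] at hscaled
  linarith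
end
end
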